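/- Let Ψ : ℝ^d → ℝ be nonnegative with ‖D²Ψ‖_∞ < ∞, and let f₀ ∈ P²_a(ℝ^{2d}) with ∫ Ψ(v) f₀ dxdv < ∞. For h sufficiently small, the variational problem minimizing A(f) := (1/(2h)) W_h(f₀, f)² + ∫_{ℝ^{2d}} Ψ(v) f(x,v) dxdv over f ∈ P²_a(ℝ^{2d}) has a unique minimizer. -/

import Mathlib

open MeasureTheory

noncomputable section

abbrev E (d : ℕ) := EuclideanSpace ℝ (Fin d)

/-- The minimal acceleration cost function. -/
noncomputable def Ch (d : ℕ) (h : ℝ) (x v x' v' : E d) : ℝ :=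
  ‖v' - v‖ ^ 2 + 12 * ‖h⁻¹ • (x' - x) - (1 / 2 : ℝ) • (v' + v)‖ ^ 2

/-- `p` is a coupling of `μ` and `ν`. -/
def IsCoupling {X : Type*} [MeasurableSpace X] (μ ν : Measure X)
    (p : Measure (X × X)) : Prop :=
  p.map Prod.fst = μ ∧ p.map Prod.snd = ν

/-- The squared Kantorovich functional `W_h(μ,ν)²` associated with the cost `C_h`. -/
noncomputable def Whsq (d : ℕ) (h : ℝ) (μ ν : Measure (E d × E d)) : ℝ :=
  sInf {c : ℝ | ∃ p : Measure ((E d × E d) × (E d × E d)), IsCoupling μ ν p ∧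
    c = ∫ z, Ch d h z.1.1 z.1.2 z.2.1 z.2.2 ∂p}

/-- `μ ∈ P²_a(ℝ^{2d})`: absolutely continuous probability measure with finite
second moment. -/
def MemP2a (d : ℕ) (μ : Measure (E d × E d)) : Prop :=
  IsProbabilityMeasure μ ∧ μ ≪ volume ∧
    Integrable (fun z : E d × E d => ‖z.1‖ ^ 2 + ‖z.2‖ ^ 2) μ

/-- The JKO-type functional `A(f) = (1/(2h)) W_h(f₀,f)² + ∫ Ψ(v) f dx dv`. -/
noncomputable def JKOFunctional (d : ℕ) (h : ℝ) (Ψ : E d → ℝ)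
    (μ₀ μ : Measure (E d × E d)) : ℝ :=
  (1 / (2 * h)) * Whsq d h μ₀ μ + ∫ z, Ψ z.2 ∂μ


lemma closed_le_of_close {X Y : Type*} [PseudoMetricSpace X] [MeasurableSpace X] [BorelSpace X]
    [MeasurableSpace Y] (μ ν : Measure X) [IsFiniteMeasure ν]
    (H : ∀ δ : ℝ, 0 < δ → ∀ ε : ℝ, 0 < ε → ∃ (P : Measure Y) (f g : Y → X), Measurable f ∧
      Measurable g ∧ P.map f = μ ∧ P.map g = ν ∧
        P {w | δ ≤ dist (f w) (g w)} ≤ ENNReal.ofReal ε)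
    (F : Set X) (hF : IsClosed F) : μ F ≤ ν F := by
  have h1 : ∀ δ : ℝ, 0 < δ → μ F ≤ ν (Metric.cthickening δ F) := by
    intro δ hδ
    refine ENNReal.le_of_forall_pos_le_add ?_
    intro ε hε _
    obtain ⟨P, f, g, hf, hg, hfm, hgm, hP⟩ := H δ hδ ε (by exact_mod_cast hε)
    rw [← hfm, ← hgm, Measure.map_apply hf hF.measurableSet,
      Measure.map_apply hg Metric.isClosed_cthickening.measurableSet]
    calc P (f ⁻¹' F) ≤ P (g ⁻¹' (Metric.cthickening δ F) ∪ {w | δ ≤ dist (f w) (g w)}) := by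
          apply measure_mono
          intro w hw
          by_cases hd : δ ≤ dist (f w) (g w)
          · right; exact hd
          · left
            push Not at hd
            refine Metric.mem_cthickening_of_dist_le (g w) (f w) δ F hw ?_
            rw [dist_comm]; exact hd.le
      _ ≤ _ := measure_union_le _ _
      _ ≤ _ := by
          gcongr
          simpa using hP
  have h2 := tendsto_measure_cthickening_of_isClosed (μ := ν) (s := F)
    ⟨1, one_pos, measure_ne_top _ _⟩ hF
  have h3 := h2.mono_left (nhdsWithin_le_nhds (s := Set.Ioi (0:ℝ)))
  refine ge_of_tendsto h3 ?_
  filter_upwards [self_mem_nhdsWithin] with δ hδ using h1 δ hδ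

lemma eq_of_close {X Y : Type*} [PseudoMetricSpace X] [MeasurableSpace X] [BorelSpace X]
    [MeasurableSpace Y] (μ ν : Measure X) [IsProbabilityMeasure μ] [IsProbabilityMeasure ν]
    (H : ∀ δ : ℝ, 0 < δ → ∀ ε : ℝ, 0 < ε → ∃ (P : Measure Y) (f g : Y → X), Measurable f ∧
      Measurable g ∧ P.map f = μ ∧ P.map g = ν ∧
        P {w | δ ≤ dist (f w) (g w)} ≤ ENNReal.ofReal ε) : μ = ν := by
  refine ext_of_generate_finite {s | IsClosed s} ?_ isPiSystem_isClosed (fun A hA ↦ ?_) (by simp)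
  · rw [BorelSpace.measurable_eq (α := X), borel_eq_generateFrom_isClosed]
  · refine le_antisymm (closed_le_of_close μ ν H A hA) (closed_le_of_close (Y := Y) ν μ ?_ A hA)
    intro δ hδ ε hε
    obtain ⟨P, f, g, hf, hg, hfm, hgm, hP⟩ := H δ hδ ε hε
    refine ⟨P, g, f, hg, hf, hgm, hfm, ?_⟩
    simpa only [dist_comm] using hP

section psi
variable {d : ℕ} {Ψ : E d → ℝ} {K : ℝ}

lemma gradient_contDiff (hΨ : ContDiff ℝ 2 Ψ) : ContDiff ℝ 1 (gradient Ψ) := by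
  have : ContDiff ℝ 1 (fderiv ℝ Ψ) := hΨ.fderiv_right (by norm_num)
  exact (InnerProductSpace.toDual ℝ (E d)).symm.contDiff.comp this

lemma fderiv_lip (hΨ : ContDiff ℝ 2 Ψ) (hK : ∀ v : E d, ‖iteratedFDeriv ℝ 2 Ψ v‖ ≤ K)
    (v w : E d) : ‖fderiv ℝ Ψ v - fderiv ℝ Ψ w‖ ≤ K * ‖v - w‖ := by
  have hd : ContDiff ℝ 1 (fderiv ℝ Ψ) := hΨ.fderiv_right (by norm_num)
  refine convex_univ.norm_image_sub_le_of_norm_fderiv_le (𝕜 := ℝ) (s := Set.univ)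
    (fun x _ => hd.differentiable (by norm_num) x) (fun x _ => ?_) trivial trivial
  rw [← norm_iteratedFDeriv_one, norm_iteratedFDeriv_fderiv]
  exact hK x

lemma gradient_lip (hΨ : ContDiff ℝ 2 Ψ) (hK : ∀ v : E d, ‖iteratedFDeriv ℝ 2 Ψ v‖ ≤ K)
    (v w : E d) : ‖gradient Ψ v - gradient Ψ w‖ ≤ K * ‖v - w‖ := by
  unfold gradient
  rw [← map_sub, LinearIsometryEquiv.norm_map]
  exact fderiv_lip hΨ hK v w

lemma taylor (hΨ : ContDiff ℝ 2 Ψ) (hK : ∀ v : E d, ‖iteratedFDeriv ℝ 2 Ψ v‖ ≤ K)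
    (v w : E d) : |Ψ w - Ψ v - inner ℝ (gradient Ψ v) (w - v)| ≤ K * ‖w - v‖ ^ 2 := by
  have hK0 : 0 ≤ K := (norm_nonneg _).trans (hK 0)
  have := (convex_closedBall v ‖w - v‖).norm_image_sub_le_of_norm_fderiv_le' (𝕜 := ℝ) (f := Ψ)
    (φ := fderiv ℝ Ψ v) (C := K * ‖w - v‖) (x := v) (y := w)
    (fun x _ => hΨ.differentiable (by norm_num) x) (fun x hx => ?_) (by simp)
    (by simp [dist_eq_norm])
  · have h2 : inner ℝ (gradient Ψ v) (w - v) = fderiv ℝ Ψ v (w - v) := by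
      simp [gradient]
    rw [h2, ← Real.norm_eq_abs]
    calc _ ≤ _ := this
      _ = _ := by ring
  · refine (fderiv_lip hΨ hK x v).trans ?_
    rw [mem_closedBall_iff_norm] at hx
    gcongr

lemma exists_prox (hΨ : ContDiff ℝ 2 Ψ) (hK : ∀ v : E d, ‖iteratedFDeriv ℝ 2 Ψ v‖ ≤ K)
    (h : ℝ) (hh : 0 < h) (hhK : h * K < 1) :
    ∃ e : E d ≃ₜ E d, ∀ w, e w = w + h • gradient Ψ w := by
  have hK0 : 0 ≤ K := (norm_nonneg _).trans (hK 0)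
  have hf : ApproximatesLinearOn (fun w => w + h • gradient Ψ w)
      ((ContinuousLinearEquiv.refl ℝ (E d) : E d ≃L[ℝ] E d) : E d →L[ℝ] E d) Set.univ
      (⟨h * K, by positivity⟩ : NNReal) := by
    intro x _ y _
    have : x + h • gradient Ψ x - (y + h • gradient Ψ y) -
      ((ContinuousLinearEquiv.refl ℝ (E d) : E d ≃L[ℝ] E d) : E d →L[ℝ] E d) (x - y)
        = h • (gradient Ψ x - gradient Ψ y) := by
      simp [smul_sub]; abel
    rw [this, norm_smul, Real.norm_eq_abs, abs_of_pos hh]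
    have := gradient_lip hΨ hK x y
    calc _ ≤ h * (K * ‖x - y‖) := by gcongr
      _ = _ := by rw [← mul_assoc]; rfl
  refine ⟨hf.toHomeomorph _ ?_, fun w => rfl⟩
  rcases subsingleton_or_nontrivial (E d) with hs | hs
  · left; exact hs
  · right
    have : ‖((ContinuousLinearEquiv.refl ℝ (E d)).symm : E d →L[ℝ] E d)‖₊ = 1 := by
      apply NNReal.eq
      exact ContinuousLinearMap.norm_id
    rw [this, inv_one]
    exact hhK

/-- The pointwise key inequality. -/
lemma key_ineq (hΨ : ContDiff ℝ 2 Ψ) (hK : ∀ v : E d, ‖iteratedFDeriv ℝ 2 Ψ v‖ ≤ K)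
    (h : ℝ) (hh : 0 < h) (hh1 : h ≤ 1) (hhK : h * K ≤ 1 / 4) (x v w x' v' : E d)
    (hw : v = w + h • gradient Ψ w) :
    (1 / (2 * h)) * Ch d h x v (x + (h / 2) • (v + w)) w + Ψ w
      + (1 / (4 * h)) * ‖((x', v') : E d × E d) - (x + (h / 2) • (v + w), w)‖ ^ 2
      ≤ (1 / (2 * h)) * Ch d h x v x' v' + Ψ v' := by
  have hT := (abs_le.1 (taylor hΨ hK w v')).1
  have hC0 : Ch d h x v (x + (h / 2) • (v + w)) w = ‖w - v‖ ^ 2 := by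
    have : h⁻¹ • (x + (h / 2) • (v + w) - x) - (1 / 2 : ℝ) • (w + v) = 0 := by
      rw [add_sub_cancel_left, smul_smul, show h⁻¹ * (h / 2) = 1 / 2 by field_simp, add_comm v w,
        sub_self]
    unfold Ch
    rw [this]
    simp
  rw [hC0]
  unfold Ch
  set r := h⁻¹ • (x' - x) - (1 / 2 : ℝ) • (v' + v) with hr
  have hx : x' - (x + (h / 2) • (v + w)) = h • r + (h / 2) • (v' - w) := by
    rw [hr, smul_sub, smul_smul, mul_inv_cancel₀ hh.ne', smul_smul]
    module
  have hexp : ‖v' - v‖ ^ 2 = ‖v' - w‖ ^ 2 - 2 * h * inner ℝ (gradient Ψ w) (v' - w)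
      + ‖w - v‖ ^ 2 := by
    have e1 : v' - v = (v' - w) + (w - v) := by abel
    have e2 : w - v = - (h • gradient Ψ w) := by rw [hw]; abel
    rw [e1, norm_add_sq_real]
    nth_rewrite 1 [e2]
    rw [inner_neg_right, inner_smul_right, real_inner_comm]
    ring
  have hN : ‖((x', v') : E d × E d) - (x + (h / 2) • (v + w), w)‖ ^ 2
      ≤ 2 * ‖r‖ ^ 2 + ‖v' - w‖ ^ 2 := by
    rw [Prod.mk_sub_mk, Prod.norm_mk, hx]
    have h1 : ‖h • r + (h / 2) • (v' - w)‖ ≤ ‖r‖ + (1 / 2) * ‖v' - w‖ := by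
      refine (norm_add_le _ _).trans ?_
      rw [norm_smul, norm_smul, Real.norm_eq_abs, Real.norm_eq_abs, abs_of_pos hh,
        abs_of_pos (by positivity)]
      have := norm_nonneg r
      have := norm_nonneg (v' - w)
      nlinarith
    rcases max_choice ‖h • r + (h / 2) • (v' - w)‖ ‖v' - w‖ with hm | hm <;> rw [hm]
    · have := pow_le_pow_left₀ (norm_nonneg _) h1 2
      nlinarith [sq_nonneg (‖r‖ - (1 / 2) * ‖v' - w‖), sq_nonneg ‖v' - w‖]
    · nlinarith [sq_nonneg ‖r‖]
  rw [hexp]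
  have hne := hh.ne'
  have hq : 0 ≤ ‖v' - w‖ ^ 2 := sq_nonneg _
  have hrr : 0 ≤ ‖r‖ ^ 2 := sq_nonneg _
  generalize ‖v' - w‖ ^ 2 = q at *
  generalize ‖r‖ ^ 2 = rr at *
  generalize ‖w - v‖ ^ 2 = s at *
  generalize inner ℝ (gradient Ψ w) (v' - w) = i at *
  generalize ‖((x', v') : E d × E d) - (x + (h / 2) • (v + w), w)‖ ^ 2 = n at *
  have hgoal : 0 ≤ (1 / (4 * h)) * (2 * (q - 2 * h * i + s + 12 * rr) + 4 * h * Ψ v'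
      - 2 * s - 4 * h * Ψ w - n) := by
    apply mul_nonneg (by positivity)
    have : h * (Ψ v' - Ψ w - i) ≥ - (h * K) * q := by
      have := mul_le_mul_of_nonneg_left hT hh.le
      linarith
    nlinarith
  have : (1 / (4 * h)) * (2 * (q - 2 * h * i + s + 12 * rr) + 4 * h * Ψ v'
      - 2 * s - 4 * h * Ψ w - n) = (1 / (2 * h)) * (q - 2 * h * i + s + 12 * rr) + Ψ v'
        - ((1 / (2 * h)) * s + Ψ w + (1 / (4 * h)) * n) := by
    field_simp
    ring
  linarith

lemma Ch_nonneg (h : ℝ) (x v x' v' : E d) : 0 ≤ Ch d h x v x' v' := by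
  unfold Ch; positivity

lemma Ch_continuous (h : ℝ) :
    Continuous (fun z : (E d × E d) × (E d × E d) => Ch d h z.1.1 z.1.2 z.2.1 z.2.2) := by
  unfold Ch; fun_prop

lemma Ch_le (h : ℝ) (hh : 0 < h) (x v x' v' : E d) :
    Ch d h x v x' v' ≤ (2 + 48 * (h⁻¹ ^ 2 + 1)) *
      ((‖x‖ ^ 2 + ‖v‖ ^ 2) + (‖x'‖ ^ 2 + ‖v'‖ ^ 2)) := by
  have h1 : ‖v' - v‖ ^ 2 ≤ 2 * (‖v‖ ^ 2 + ‖v'‖ ^ 2) := by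
    have := pow_le_pow_left₀ (norm_nonneg _) (norm_sub_le v' v) 2
    nlinarith [sq_nonneg (‖v'‖ - ‖v‖)]
  have h2 : ‖h⁻¹ • (x' - x) - (1 / 2 : ℝ) • (v' + v)‖ ≤
      h⁻¹ * (‖x'‖ + ‖x‖) + (1 / 2) * (‖v'‖ + ‖v‖) := by
    refine (norm_sub_le _ _).trans ?_
    rw [norm_smul, norm_smul, Real.norm_eq_abs, Real.norm_eq_abs, abs_of_pos (by positivity),
      abs_of_pos (by positivity)]
    gcongr
    · exact norm_sub_le _ _
    · exact norm_add_le _ _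
  have h3 := pow_le_pow_left₀ (norm_nonneg _) h2 2
  have h4 : (h⁻¹ * (‖x'‖ + ‖x‖) + (1 / 2) * (‖v'‖ + ‖v‖)) ^ 2 ≤
      4 * (h⁻¹ ^ 2 * (‖x‖ ^ 2 + ‖x'‖ ^ 2)) + (‖v‖ ^ 2 + ‖v'‖ ^ 2) := by
    have a1 := sq_nonneg (h⁻¹ * (‖x'‖ + ‖x‖) - (1 / 2) * (‖v'‖ + ‖v‖))
    have a2 := mul_nonneg (sq_nonneg h⁻¹) (sq_nonneg (‖x'‖ - ‖x‖))
    have a3 := sq_nonneg (‖v'‖ - ‖v‖)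
    nlinarith
  unfold Ch
  have b1 : 0 ≤ h⁻¹ ^ 2 * (‖v‖ ^ 2 + ‖v'‖ ^ 2) := by positivity
  have b2 : 0 ≤ ‖x‖ ^ 2 + ‖x'‖ ^ 2 := by positivity
  have b3 : 0 ≤ ‖v‖ ^ 2 + ‖v'‖ ^ 2 := by positivity
  nlinarith

lemma Ch_integrable (h : ℝ) (hh : 0 < h) {μ ν : Measure (E d × E d)}
    {p : Measure ((E d × E d) × (E d × E d))} (hp : IsCoupling μ ν p)
    (hμ : Integrable (fun z : E d × E d => ‖z.1‖ ^ 2 + ‖z.2‖ ^ 2) μ)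
    (hν : Integrable (fun z : E d × E d => ‖z.1‖ ^ 2 + ‖z.2‖ ^ 2) ν) :
    Integrable (fun z => Ch d h z.1.1 z.1.2 z.2.1 z.2.2) p := by
  obtain ⟨rfl, rfl⟩ := hp
  have h1 := hμ.comp_measurable measurable_fst
  have h2 := hν.comp_measurable measurable_snd
  refine ((h1.add h2).const_mul (2 + 48 * (h⁻¹ ^ 2 + 1))).mono'
    (Ch_continuous h).aestronglyMeasurable (ae_of_all _ fun z => ?_)
  rw [Real.norm_eq_abs, abs_of_nonneg (Ch_nonneg _ _ _ _ _)]
  exact Ch_le h hh _ _ _ _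

lemma Psi_integrable (hΨ0 : ∀ v, 0 ≤ Ψ v) (hΨ : ContDiff ℝ 2 Ψ)
    (hK : ∀ v : E d, ‖iteratedFDeriv ℝ 2 Ψ v‖ ≤ K)
    {ν : Measure (E d × E d)} [IsFiniteMeasure ν]
    (hν : Integrable (fun z : E d × E d => ‖z.1‖ ^ 2 + ‖z.2‖ ^ 2) ν) :
    Integrable (fun z => Ψ z.2) ν := by
  have hK0 : 0 ≤ K := (norm_nonneg _).trans (hK 0)
  have hc : Continuous fun z : E d × E d => Ψ z.2 := hΨ.continuous.comp continuous_snd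
  refine ((integrable_const (Ψ 0 + ‖gradient Ψ 0‖ ^ 2)).add (hν.const_mul (1 + K))).mono'
    hc.aestronglyMeasurable (ae_of_all _ fun z => ?_)
  rw [Real.norm_eq_abs, abs_of_nonneg (hΨ0 _)]
  have h1 := (abs_le.1 (taylor hΨ hK 0 z.2)).2
  rw [sub_zero] at h1
  have h2 := real_inner_le_norm (gradient Ψ 0) z.2
  simp only [Pi.add_apply]
  have h3 : 0 ≤ K * ‖z.1‖ ^ 2 := by positivity
  nlinarith [sq_nonneg (‖gradient Ψ 0‖ - ‖z.2‖), sq_nonneg ‖z.1‖, sq_nonneg ‖z.2‖,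
    sq_nonneg ‖gradient Ψ 0‖]

lemma prob_of_coupling {μ ν : Measure (E d × E d)} [IsProbabilityMeasure μ]
    {p : Measure ((E d × E d) × (E d × E d))} (hp : IsCoupling μ ν p) :
    IsProbabilityMeasure p := by
  constructor
  have := congrArg (fun m => m Set.univ) hp.1
  simpa [Measure.map_apply measurable_fst MeasurableSet.univ] using this

/-- Integrated key inequality for a coupling. -/
lemma coupling_ineq (hΨ0 : ∀ v, 0 ≤ Ψ v) (hΨ : ContDiff ℝ 2 Ψ)
    (h : ℝ) (hh : 0 < h)
    {μ ν : Measure (E d × E d)}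
    {p : Measure ((E d × E d) × (E d × E d))} (hp : IsCoupling μ ν p)
    (hC : Integrable (fun z => Ch d h z.1.1 z.1.2 z.2.1 z.2.2) p)
    (hP : Integrable (fun z => Ψ z.2) ν)
    (T : E d × E d → E d × E d) (hT : Continuous T)
    (key : ∀ z z' : E d × E d, (1 / (2 * h)) * Ch d h z.1 z.2 (T z).1 (T z).2 + Ψ (T z).2
      + (1 / (4 * h)) * ‖z' - T z‖ ^ 2
      ≤ (1 / (2 * h)) * Ch d h z.1 z.2 z'.1 z'.2 + Ψ z'.2) :
    Integrable (fun z => (1 / (2 * h)) * Ch d h z.1 z.2 (T z).1 (T z).2 + Ψ (T z).2) μ ∧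
    Integrable (fun z : (E d × E d) × (E d × E d) => ‖z.2 - T z.1‖ ^ 2) p ∧
    (∫ z, ((1 / (2 * h)) * Ch d h z.1 z.2 (T z).1 (T z).2 + Ψ (T z).2) ∂μ)
      + (1 / (4 * h)) * (∫ z, ‖z.2 - T z.1‖ ^ 2 ∂p) ≤
    (1 / (2 * h)) * (∫ z, Ch d h z.1.1 z.1.2 z.2.1 z.2.2 ∂p) + ∫ z, Ψ z.2 ∂ν := by
  obtain ⟨rfl, rfl⟩ := hp
  have hcT : Continuous (fun z : E d × E d =>
      (1 / (2 * h)) * Ch d h z.1 z.2 (T z).1 (T z).2 + Ψ (T z).2) := by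
    have h1 := (Ch_continuous (d := d) h).comp (continuous_id.prodMk hT)
    have h2 := hΨ.continuous.comp (continuous_snd.comp hT)
    exact (continuous_const.mul h1).add h2
  have hcΨ : Continuous (fun z : E d × E d => Ψ z.2) := hΨ.continuous.comp continuous_snd
  have hP' : Integrable (fun z : (E d × E d) × (E d × E d) => Ψ z.2.2) p :=
    hP.comp_measurable measurable_snd
  have htot := (hC.const_mul (1 / (2 * h))).add hP'
  have hm0 : ∀ z : E d × E d,
      0 ≤ (1 / (2 * h)) * Ch d h z.1 z.2 (T z).1 (T z).2 + Ψ (T z).2 := fun z => by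
    have := Ch_nonneg h z.1 z.2 (T z).1 (T z).2
    have := hΨ0 (T z).2
    positivity
  have hq0 : ∀ z : (E d × E d) × (E d × E d), 0 ≤ (1 / (4 * h)) * ‖z.2 - T z.1‖ ^ 2 :=
    fun z => by positivity
  have i1 : Integrable (fun z : (E d × E d) × (E d × E d) =>
      (1 / (2 * h)) * Ch d h z.1.1 z.1.2 (T z.1).1 (T z.1).2 + Ψ (T z.1).2) p := by
    refine htot.mono' (hcT.comp continuous_fst).aestronglyMeasurable (ae_of_all _ fun z => ?_)
    rw [Real.norm_eq_abs, abs_of_nonneg (hm0 z.1)]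
    exact (le_add_of_nonneg_right (hq0 z)).trans (key z.1 z.2)
  have i2 : Integrable (fun z : (E d × E d) × (E d × E d) =>
      (1 / (4 * h)) * ‖z.2 - T z.1‖ ^ 2) p := by
    refine htot.mono' ?_ (ae_of_all _ fun z => ?_)
    · apply Continuous.aestronglyMeasurable
      fun_prop
    rw [Real.norm_eq_abs, abs_of_nonneg (hq0 z)]
    exact (le_add_of_nonneg_left (hm0 z.1)).trans (key z.1 z.2)
  refine ⟨?_, ?_, ?_⟩
  · rw [integrable_map_measure hcT.aestronglyMeasurable measurable_fst.aemeasurable]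
    exact i1
  · have := i2.const_mul (4 * h)
    refine this.congr (ae_of_all _ fun z => ?_)
    simp only
    field_simp
  · rw [integral_map measurable_fst.aemeasurable hcT.aestronglyMeasurable,
      integral_map measurable_snd.aemeasurable hcΨ.aestronglyMeasurable,
      ← integral_const_mul, ← integral_const_mul, ← integral_add i1 i2,
      ← integral_add (hC.const_mul _) hP']
    exact integral_mono (i1.add i2) htot fun z => key z.1 z.2

lemma Whsq_bddBelow (h : ℝ) (μ ν : Measure (E d × E d)) :
    BddBelow {c : ℝ | ∃ p : Measure ((E d × E d) × (E d × E d)), IsCoupling μ ν p ∧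
    c = ∫ z, Ch d h z.1.1 z.1.2 z.2.1 z.2.2 ∂p} := by
  refine ⟨0, ?_⟩
  rintro c ⟨p, -, rfl⟩
  exact integral_nonneg fun z => Ch_nonneg _ _ _ _ _

lemma Whsq_nonempty (h : ℝ) (μ ν : Measure (E d × E d)) [IsProbabilityMeasure μ]
    [IsProbabilityMeasure ν] :
    {c : ℝ | ∃ p : Measure ((E d × E d) × (E d × E d)), IsCoupling μ ν p ∧
    c = ∫ z, Ch d h z.1.1 z.1.2 z.2.1 z.2.2 ∂p}.Nonempty :=
  ⟨_, μ.prod ν, ⟨by simp [Measure.map_fst_prod], by simp [Measure.map_snd_prod]⟩, rfl⟩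

end psi

/-- For `Ψ ≥ 0` of class `C²` with bounded Hessian and `f₀ ∈ P²_a(ℝ^{2d})` with
`∫ Ψ(v) f₀ < ∞`, for `h` sufficiently small the variational problem minimizing
`A(f) = (1/(2h)) W_h(f₀,f)² + ∫ Ψ(v) f` over `P²_a(ℝ^{2d})` has a unique
minimizer. -/
theorem JKO_unique_minimizer {d : ℕ} (Ψ : E d → ℝ) (hΨ0 : ∀ v, 0 ≤ Ψ v)
    (hΨ : ContDiff ℝ 2 Ψ) (K : ℝ)
    (hK : ∀ v : E d, ‖iteratedFDeriv ℝ 2 Ψ v‖ ≤ K)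
    (μ₀ : Measure (E d × E d)) (hμ₀ : MemP2a d μ₀)
    (hΨμ₀ : Integrable (fun z : E d × E d => Ψ z.2) μ₀) :
    ∃ h₀ > (0 : ℝ), ∀ h : ℝ, 0 < h → h < h₀ →
      ∃! μ : Measure (E d × E d), MemP2a d μ ∧
        ∀ ν : Measure (E d × E d), MemP2a d ν →
          JKOFunctional d h Ψ μ₀ μ ≤ JKOFunctional d h Ψ μ₀ ν := by
  have hK0 : 0 ≤ K := (norm_nonneg _).trans (hK 0)
  refine ⟨1 / (4 * (K + 1)), by positivity, ?_⟩
  intro h hh hlt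
  have hlt' : h * (4 * (K + 1)) < 1 := by rwa [lt_div_iff₀ (by positivity)] at hlt
  have hh1 : h ≤ 1 := by nlinarith [mul_nonneg hh.le hK0]
  have hhK : h * K ≤ 1 / 4 := by nlinarith
  obtain ⟨e, he⟩ := exists_prox hΨ hK h hh (by linarith)
  obtain ⟨hprob, hac, hmom⟩ := hμ₀
  let T : E d × E d → E d × E d :=
    fun z => (z.1 + (h / 2) • (z.2 + e.symm z.2), e.symm z.2)
  have hTc : Continuous T := by
    have := e.symm.continuous
    fun_prop
  let S : E d × E d → E d × E d :=
    fun z => (z.1 - (h / 2) • ((z.2 + h • gradient Ψ z.2) + z.2), z.2 + h • gradient Ψ z.2)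
  have hST : ∀ z, S (T z) = z := by
    intro z
    have h1 : e.symm z.2 + h • gradient Ψ (e.symm z.2) = z.2 := by rw [← he]; simp
    simp only [S, T, h1]
    simp
  have hSd : Differentiable ℝ S := by
    have := (gradient_contDiff hΨ).differentiable (by norm_num)
    have h2 : Differentiable ℝ (fun z : E d × E d => gradient Ψ z.2) :=
      this.comp differentiable_snd
    fun_prop
  have key : ∀ z z' : E d × E d, (1 / (2 * h)) * Ch d h z.1 z.2 (T z).1 (T z).2 + Ψ (T z).2
      + (1 / (4 * h)) * ‖z' - T z‖ ^ 2
      ≤ (1 / (2 * h)) * Ch d h z.1 z.2 z'.1 z'.2 + Ψ z'.2 := by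
    intro z z'
    exact key_ineq hΨ hK h hh hh1 hhK z.1 z.2 (e.symm z.2) z'.1 z'.2 (by rw [← he]; simp)
  set μ : Measure (E d × E d) := μ₀.map T with hμdef
  have hμprob : IsProbabilityMeasure μ := Measure.isProbabilityMeasure_map hTc.aemeasurable
  have hμac : μ ≪ volume := by
    refine Measure.AbsolutelyContinuous.mk fun A hA hA0 => ?_
    rw [hμdef, Measure.map_apply hTc.measurable hA]
    refine measure_mono_null (t := S '' A) (fun z hz => ⟨T z, hz, hST z⟩) (hac ?_)
    have : Measure.IsAddHaarMeasure (volume : Measure (E d × E d)) := by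
      rw [Measure.volume_eq_prod]; infer_instance
    exact addHaar_image_eq_zero_of_differentiableOn_of_addHaar_eq_zero volume
      hSd.differentiableOn hA0
  -- the diagonal coupling controls the second moment of `μ`
  have hdiag : IsCoupling μ₀ μ₀ (μ₀.map fun z => (z, z)) := by
    constructor
    · rw [Measure.map_map measurable_fst (by fun_prop)]; exact Measure.map_id
    · rw [Measure.map_map measurable_snd (by fun_prop)]; exact Measure.map_id
  have hdq := (coupling_ineq hΨ0 hΨ h hh hdiag (Ch_integrable h hh hdiag hmom hmom) hΨμ₀ T hTc
    key).2.1
  have hdq' : Integrable (fun z => ‖z - T z‖ ^ 2) μ₀ :=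
    hdq.comp_measurable (f := fun z : E d × E d => (z, z)) (by fun_prop)
  have hμmom : Integrable (fun z : E d × E d => ‖z.1‖ ^ 2 + ‖z.2‖ ^ 2) μ := by
    rw [hμdef, integrable_map_measure (Continuous.aestronglyMeasurable (by fun_prop))
      hTc.aemeasurable]
    refine ((hmom.const_mul 4).add (hdq'.const_mul 4)).mono'
      (Continuous.aestronglyMeasurable (by fun_prop)) (ae_of_all _ fun z => ?_)
    simp only [Function.comp, Pi.add_apply]
    rw [Real.norm_eq_abs, abs_of_nonneg (by positivity)]
    have a1 : ‖(T z).1‖ ≤ ‖z.1‖ + ‖z - T z‖ := by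
      have h1 : ‖z.1 - (T z).1‖ ≤ ‖z - T z‖ := norm_fst_le (z - T z)
      have h2 := norm_sub_norm_le (T z).1 z.1
      rw [norm_sub_rev] at h2
      linarith
    have a2 : ‖(T z).2‖ ≤ ‖z.2‖ + ‖z - T z‖ := by
      have h1 : ‖z.2 - (T z).2‖ ≤ ‖z - T z‖ := norm_snd_le (z - T z)
      have h2 := norm_sub_norm_le (T z).2 z.2
      rw [norm_sub_rev] at h2
      linarith
    have b1 := pow_le_pow_left₀ (norm_nonneg _) a1 2
    have b2 := pow_le_pow_left₀ (norm_nonneg _) a2 2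
    nlinarith [sq_nonneg (‖z.1‖ - ‖z - T z‖), sq_nonneg (‖z.2‖ - ‖z - T z‖),
      sq_nonneg ‖z.1‖, sq_nonneg ‖z.2‖]
  have hμmem : MemP2a d μ := ⟨hμprob, hμac, hμmom⟩
  set m : ℝ := ∫ z, ((1 / (2 * h)) * Ch d h z.1 z.2 (T z).1 (T z).2 + Ψ (T z).2) ∂μ₀ with hm
  -- upper bound
  have hTcoup : IsCoupling μ₀ μ (μ₀.map fun z => (z, T z)) := by
    have hmeas : Measurable fun z => (z, T z) := measurable_id.prodMk hTc.measurable
    constructor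
    · rw [Measure.map_map measurable_fst hmeas]; exact Measure.map_id
    · rw [Measure.map_map measurable_snd hmeas]; rfl
  have hup : JKOFunctional d h Ψ μ₀ μ ≤ m := by
    have hmeas : Measurable fun z => (z, T z) := measurable_id.prodMk hTc.measurable
    have iC := Ch_integrable h hh hTcoup hmom hμmom
    have iC' : Integrable (fun z => Ch d h z.1 z.2 (T z).1 (T z).2) μ₀ := iC.comp_measurable hmeas
    have iP := Psi_integrable hΨ0 hΨ hK hμmom
    have iP' : Integrable (fun z => Ψ (T z).2) μ₀ := iP.comp_measurable hTc.measurable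
    have e1 : ∫ z, Ψ z.2 ∂μ = ∫ z, Ψ (T z).2 ∂μ₀ :=
      integral_map hTc.aemeasurable iP.aestronglyMeasurable
    have e2 : Whsq d h μ₀ μ ≤ ∫ z, Ch d h z.1 z.2 (T z).1 (T z).2 ∂μ₀ := by
      refine csInf_le (Whsq_bddBelow h μ₀ μ) ⟨_, hTcoup, ?_⟩
      exact (integral_map hmeas.aemeasurable iC.aestronglyMeasurable).symm
    rw [hm, integral_add (iC'.const_mul _) iP', integral_const_mul]
    unfold JKOFunctional
    rw [e1]
    gcongr
  -- near-optimal couplings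
  have hlow : ∀ ν, MemP2a d ν → ∀ ε : ℝ, 0 < ε → ∃ p, IsCoupling μ₀ ν p ∧
      Integrable (fun z : (E d × E d) × (E d × E d) => ‖z.2 - T z.1‖ ^ 2) p ∧
      m + (1 / (4 * h)) * (∫ z, ‖z.2 - T z.1‖ ^ 2 ∂p) ≤ JKOFunctional d h Ψ μ₀ ν + ε := by
    rintro ν ⟨hνp, hνa, hνm⟩ ε hε
    obtain ⟨c, ⟨p, hp, rfl⟩, hc⟩ := exists_lt_of_csInf_lt (Whsq_nonempty h μ₀ ν)
      (show Whsq d h μ₀ ν < Whsq d h μ₀ ν + 2 * h * ε by linarith [mul_pos hh hε])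
    obtain ⟨-, h2, h3⟩ := coupling_ineq hΨ0 hΨ h hh hp (Ch_integrable h hh hp hmom hνm)
      (Psi_integrable hΨ0 hΨ hK hνm) T hTc key
    refine ⟨p, hp, h2, h3.trans ?_⟩
    unfold JKOFunctional
    have := mul_le_mul_of_nonneg_left hc.le (show 0 ≤ 1 / (2 * h) by positivity)
    have e : (1 / (2 * h)) * (Whsq d h μ₀ ν + 2 * h * ε)
        = (1 / (2 * h)) * Whsq d h μ₀ ν + ε := by field_simp
    linarith
  refine ⟨μ, ⟨hμmem, fun ν hν => ?_⟩, ?_⟩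
  · refine hup.trans (le_of_forall_pos_le_add fun ε hε => ?_)
    obtain ⟨p, -, -, h3⟩ := hlow ν hν ε hε
    have : 0 ≤ (1 / (4 * h)) * (∫ z, ‖z.2 - T z.1‖ ^ 2 ∂p) := by
      have : 0 ≤ ∫ z, ‖z.2 - T z.1‖ ^ 2 ∂p := integral_nonneg fun z => by positivity
      positivity
    linarith
  · rintro ν ⟨hν, hmin⟩
    have hνle : JKOFunctional d h Ψ μ₀ ν ≤ m := (hmin μ hμmem).trans hup
    have hνp := hν.1
    refine eq_of_close (Y := (E d × E d) × (E d × E d)) ν μ ?_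
    intro δ hδ ε hε
    obtain ⟨p, hp, h2, h3⟩ := hlow ν hν (δ ^ 2 * ε / (4 * h)) (by positivity)
    have hpp := prob_of_coupling hp
    refine ⟨p, fun z => z.2, fun z => T z.1, measurable_snd, hTc.measurable.comp measurable_fst,
      hp.2, ?_, ?_⟩
    · rw [hμdef, ← hp.1, Measure.map_map hTc.measurable measurable_fst]; rfl
    · have hI : (∫ z, ‖z.2 - T z.1‖ ^ 2 ∂p) ≤ δ ^ 2 * ε := by
        have h4 : (1 / (4 * h)) * (∫ z, ‖z.2 - T z.1‖ ^ 2 ∂p) ≤ δ ^ 2 * ε / (4 * h) := by linarith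
        have h5 := mul_le_mul_of_nonneg_left h4 (show 0 ≤ 4 * h by positivity)
        have e1 : (4 * h) * ((1 / (4 * h)) * (∫ z, ‖z.2 - T z.1‖ ^ 2 ∂p))
          = ∫ z, ‖z.2 - T z.1‖ ^ 2 ∂p := by field_simp
        have e2 : (4 * h) * (δ ^ 2 * ε / (4 * h)) = δ ^ 2 * ε := by field_simp
        rwa [e1, e2] at h5
      have hM := mul_meas_ge_le_integral_of_nonneg
        (ae_of_all p fun z : (E d × E d) × (E d × E d) => sq_nonneg ‖z.2 - T z.1‖) h2 (δ ^ 2)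
      have hset : {w : (E d × E d) × (E d × E d) | δ ≤ dist w.2 (T w.1)}
          ⊆ {w | δ ^ 2 ≤ ‖w.2 - T w.1‖ ^ 2} := by
        intro w hw
        have hw' : δ ≤ ‖w.2 - T w.1‖ := by rw [← dist_eq_norm]; exact hw
        exact pow_le_pow_left₀ hδ.le hw' 2
      refine (measure_mono hset).trans ?_
      rw [← ofReal_measureReal]
      apply ENNReal.ofReal_le_ofReal
      exact le_of_mul_le_mul_left (hM.trans hI) (by positivity)
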